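/- arXiv:math/9912058 — 2 statements merged into one kernel-verified Lean document; each statement's English description precedes it below -/
import Mathlib

section
/- Let A be a commutative integral domain with fraction field K, and let A' be a subring of K containing A which is finitely generated as an A-algebra. Then there exist an ideal I of A and a nonzero element f ∈ I such that A' equals the affine modification A[I/f], i.e. A' is the A-subalgebra of K generated by the fractions b/f with b ∈ I. (Every birational morphism of affine algebraic varieties is an affine modification.) -/
/-- The affine modification `A[I/f]` of a domain `A` inside a field `K` containing `A`:
the `A`-subalgebra of `K` generated by the fractions `b/f` with `b ∈ I`. -/
def affineModification (A K : Type*) [CommRing A] [Field K] [Algebra A K]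
    (I : Ideal A) (f : A) : Subalgebra A K :=
  Algebra.adjoin A ((fun b => algebraMap A K b / algebraMap A K f) '' (I : Set A))

/-- **Theorem 2.1(2)**: every birational morphism of affine varieties is an affine
modification.  Algebraically: if `A` is a domain with fraction field `K` and `A'` is a
subring of `K` containing `A` which is finitely generated as an `A`-algebra, then there
are an ideal `I` of `A` and a nonzero `f ∈ I` with `A' = A[I/f]`. -/
theorem stmt1 (A K : Type*) [CommRing A] [IsDomain A] [Field K] [Algebra A K]
    [IsFractionRing A K] (A' : Subalgebra A K) (hfg : A'.FG) :
    ∃ (I : Ideal A) (f : A), f ∈ I ∧ f ≠ 0 ∧ A' = affineModification A K I f := by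
  obtain ⟨S, rfl⟩ := hfg
  obtain ⟨f, hf⟩ := IsLocalization.exist_integer_multiples_of_finset (nonZeroDivisors A) S
  have hf0 : (f : A) ≠ 0 := nonZeroDivisors.ne_zero f.2
  have hfK : algebraMap A K f ≠ 0 := by simp
  let I : Ideal A := (Subalgebra.toSubmodule (Algebra.adjoin A (S : Set K))).comap
    ((LinearMap.mulRight A (algebraMap A K f)⁻¹).comp (Algebra.linearMap A K))
  have hI : ∀ b, b ∈ I ↔ algebraMap A K b / algebraMap A K f ∈ Algebra.adjoin A (S : Set K) := by
    intro b
    simp [I, div_eq_mul_inv]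
  refine ⟨I, f, ?_, hf0, le_antisymm (Algebra.adjoin_le fun s hs => ?_) (Algebra.adjoin_le ?_)⟩
  · rw [hI, div_self hfK]
    exact one_mem _
  · obtain ⟨b, hb⟩ := hf s hs
    have hbs : algebraMap A K b / algebraMap A K f = s := by
      rw [hb, Algebra.smul_def, mul_div_cancel_left₀ _ hfK]
    refine Algebra.subset_adjoin ⟨b, (hI b).2 ?_, hbs⟩
    rw [hbs]
    exact Algebra.subset_adjoin hs
  · rintro _ ⟨b, hb, rfl⟩
    exact (hI b).1 hb
end

section
/- Let A be a Noetherian integral domain with fraction field K which is Cohen–Macaulay, i.e. the localization of A at every maximal ideal is a Cohen–Macaulay local ring. Let b₀ = f, b₁, …, b_s be a semi-regular sequence in A, meaning the ideal I generated by b₀, …, b_s has height s + 1, with f ≠ 0. Then the affine modification A ↪ A' = A[I/f] is a Davis modification: the ideal J' of the polynomial ring A[y₁, …, y_s] generated by the elements f·y_i − b_i (i = 1, …, s) is prime and equals the kernel of the A-algebra homomorphism β : A[y₁, …, y_s] → K sending y_i to b_i/f. -/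
/-- The ideal `J'` of the polynomial ring `B[y₁, …, y_s]` generated by the elements
`L_i = f·y_i − c_i`. -/
noncomputable def davisIdeal (B : Type*) [CommRing B] (s : ℕ) (f : B) (c : Fin s → B) :
    Ideal (MvPolynomial (Fin s) B) :=
  Ideal.span (Set.range fun i : Fin s =>
    MvPolynomial.C f * MvPolynomial.X i - MvPolynomial.C (c i))

/-- The `B`-algebra homomorphism `β : B[y₁, …, y_s] → K`, `y_i ↦ c_i/f`, whose image is
the affine modification `B[c₁/f, …, c_s/f] ⊆ K`. -/
noncomputable def davisHom (B K : Type*) [CommRing B] [Field K] [Algebra B K] (s : ℕ)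
    (f : B) (c : Fin s → B) : MvPolynomial (Fin s) B →ₐ[B] K :=
  MvPolynomial.aeval fun i => algebraMap B K (c i) / algebraMap B K f

/-- The height of an ideal `I` of a commutative ring: the infimum of the heights (in the
prime spectrum) of the prime ideals containing `I`. -/
noncomputable def idealHeight {A : Type*} [CommRing A] (I : Ideal A) : ℕ∞ :=
  ⨅ p ∈ {p : PrimeSpectrum A | I ≤ p.asIdeal}, Order.height p

/-- A (Noetherian) local ring is Cohen–Macaulay if its depth equals its Krull dimension,
i.e. there is a regular sequence in the maximal ideal whose length is the Krull
dimension of the ring. -/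
def IsCMLocalRing (R : Type*) [CommRing R] [IsLocalRing R] : Prop :=
  ∃ rs : List R, (∀ r ∈ rs, r ∈ IsLocalRing.maximalIdeal R) ∧
    RingTheory.Sequence.IsRegular R rs ∧ ringKrullDim R = rs.length

/-- A commutative ring is Cohen–Macaulay if its localization at every maximal ideal is a
Cohen–Macaulay local ring. -/
def IsCMRing (R : Type*) [CommRing R] : Prop :=
  ∀ (M : Ideal R) (hM : M.IsMaximal),
    haveI := hM.isPrime
    IsCMLocalRing (Localization.AtPrime M)

section

open IsLocalRing RingTheory.Sequence Ideal Pointwise CategoryTheory Abelian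

theorem exists_isAssociatedPrime_quotSMulTop_lt {R M : Type*} [CommRing R] [IsNoetherianRing R]
    [IsLocalRing R] [AddCommGroup M] [Module R M] [Module.Finite R M] {x : R}
    (hx : x ∈ maximalIdeal R) (hreg : IsSMulRegular M x) {p : Ideal R}
    (hp : IsAssociatedPrime p M) :
    ∃ q : Ideal R, IsAssociatedPrime q (QuotSMulTop x M) ∧ p < q := by
  obtain ⟨hpp, z, hz⟩ := isAssociatedPrime_iff.mp hp
  have hann : ∀ a : R, a ∈ p ↔ a • z = 0 := fun a => by
    rw [hz, Submodule.mem_colon_singleton, Submodule.mem_bot]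
  have hz0 : z ≠ 0 := fun h => hpp.ne_top ((eq_top_iff_one _).mpr ((hann 1).mpr (by simp [h])))
  have hxp : x ∉ p := fun h => hz0 (hreg (by simpa using (hann x).mp h))
  let N : Submodule R M :=
    { carrier := {m | ∀ a ∈ p, a • m = 0}
      add_mem' := fun hm hn a ha => by rw [smul_add, hm a ha, hn a ha, add_zero]
      zero_mem' := fun a _ => smul_zero a
      smul_mem' := fun c m hm a ha => by rw [smul_comm, hm a ha, smul_zero] }
  have hzN : z ∈ N := fun a ha => (hann a).mp ha
  have hnot : ¬ N ≤ x • (⊤ : Submodule R M) := by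
    intro hle
    have hNN : N ≤ Ideal.span {x} • N := by
      intro n hn
      obtain ⟨m, -, rfl⟩ := (Submodule.mem_smul_pointwise_iff_exists _ _ _).mp (hle hn)
      refine Submodule.smul_mem_smul (mem_span_singleton_self x) fun a ha => hreg ?_
      have := hn a ha
      rw [smul_comm] at this
      simpa using this
    have hbot := Submodule.eq_bot_of_le_smul_of_le_jacobson_bot (Ideal.span {x}) N
      (IsNoetherian.noetherian N) hNN (by
        rw [jacobson_eq_maximalIdeal _ bot_ne_top]
        simpa [Ideal.span_le] using hx)
    exact hz0 (by simpa [hbot] using hzN)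
  obtain ⟨n, hn, hnx⟩ := SetLike.not_le_iff_exists.mp hnot
  obtain ⟨q, hq, hle⟩ := exists_le_isAssociatedPrime_of_isNoetherianRing R
    (Submodule.Quotient.mk n : QuotSMulTop x M)
    (by rwa [Ne, Submodule.Quotient.mk_eq_zero])
  have hmem : ∀ a : R, a • n ∈ x • (⊤ : Submodule R M) → a ∈ q := fun a ha => hle <| by
    rw [Submodule.mem_colon_singleton, Submodule.mem_bot, ← Submodule.Quotient.mk_smul,
      Submodule.Quotient.mk_eq_zero]
    exact ha
  refine ⟨q, hq, lt_of_le_of_ne (fun a ha => hmem a (by rw [hn a ha]; exact zero_mem _)) ?_⟩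
  rintro rfl
  exact hxp (hmem x (Submodule.smul_mem_pointwise_smul n x ⊤ trivial))

theorem length_le_coheight_of_isAssociatedPrime {R : Type*} [CommRing R] [IsNoetherianRing R]
    [IsLocalRing R] (rs : List R) (hrs : ∀ r ∈ rs, r ∈ maximalIdeal R) {M : Type*}
    [AddCommGroup M] [Module R M] [Module.Finite R M] (hreg : IsWeaklyRegular M rs)
    (p : PrimeSpectrum R) (hp : IsAssociatedPrime p.asIdeal M) :
    (rs.length : ℕ∞) ≤ Order.coheight p := by
  induction rs generalizing M p with
  | nil => simp
  | cons x rs ih =>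
    obtain ⟨hx, hrs'⟩ := (isWeaklyRegular_cons_iff M x rs).mp hreg
    obtain ⟨q, hq, hlt⟩ := exists_isAssociatedPrime_quotSMulTop_lt
      (hrs x List.mem_cons_self) hx hp
    have h1 := ih (fun r hr => hrs r (List.mem_cons_of_mem x hr)) hrs' ⟨q, hq.isPrime⟩ hq
    have h2 : p < (⟨q, hq.isPrime⟩ : PrimeSpectrum R) := hlt
    calc ((x :: rs).length : ℕ∞) = rs.length + 1 := by simp
      _ ≤ Order.coheight (⟨q, hq.isPrime⟩ : PrimeSpectrum R) + 1 := by gcongr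
      _ ≤ _ := Order.coheight_add_one_le h2

theorem exists_isRegular_quotSMulTop.{u} {R M : Type u} [CommRing R] [IsNoetherianRing R]
    [IsLocalRing R] [AddCommGroup M] [Module R M] [Module.Finite R M] {x : R}
    (hx : x ∈ maximalIdeal R) (hreg : IsSMulRegular M x) {n : ℕ}
    (h : ∃ rs : List R, rs.length = n + 1 ∧ (∀ r ∈ rs, r ∈ maximalIdeal R) ∧ IsRegular M rs) :
    ∃ rs : List R, rs.length = n ∧ (∀ r ∈ rs, r ∈ maximalIdeal R) ∧
      IsRegular (QuotSMulTop x M) rs := by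
  have : Nontrivial M := by
    obtain ⟨rs, -, -, hrs⟩ := h
    exact hrs.nontrivial
  have : Nontrivial (QuotSMulTop x M) := nontrivial_quotSMulTop_of_mem_maximalIdeal M hx
  have hlt : ∀ (L : Type u) [AddCommGroup L] [Module R L] [Module.Finite R L] [Nontrivial L],
      maximalIdeal R • (⊤ : Submodule R L) < ⊤ := fun L _ _ _ _ =>
    (Submodule.top_ne_ideal_smul_of_le_jacobson_annihilator
      (maximalIdeal_le_jacobson _)).symm.lt_top
  have hE := ((ModuleCat.exists_isRegular_tfae (maximalIdeal R) (n + 1) (ModuleCat.of R M)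
    (hlt M)).out 1 3).mpr h
  refine ((ModuleCat.exists_isRegular_tfae (maximalIdeal R) n
    (ModuleCat.of R (QuotSMulTop x M)) (hlt _)).out 1 3).mp fun i hi => ?_
  have zero1 := AddCommGrpCat.isZero_of_iff_subsingleton.mpr (hE i (by omega))
  have zero2 := AddCommGrpCat.isZero_of_iff_subsingleton.mpr (hE (i + 1) (by omega))
  exact AddCommGrpCat.subsingleton_of_isZero <| ShortComplex.Exact.isZero_of_both_zeros
    ((Ext.covariant_sequence_exact₃' _
      (IsSMulRegular.smulShortComplex_shortExact (M := ModuleCat.of R M) hreg)) i (i + 1) rfl)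
    (zero1.eq_zero_of_src _) (zero2.eq_zero_of_tgt _)

theorem coheight_le_supportDim {R M : Type*} [CommRing R] [AddCommGroup M] [Module R M]
    {p : PrimeSpectrum R} (hp : p ∈ Module.support R M) {n : ℕ}
    (hn : (n : ℕ∞) ≤ Order.coheight p) : (n : WithBot ℕ∞) ≤ Module.supportDim R M := by
  obtain ⟨q, hq, rfl⟩ := Order.exists_series_of_le_coheight p hn
  let q' : LTSeries (Module.support R M) :=
    { length := q.length
      toFun := fun i => ⟨q i, Module.mem_support_mono (hq ▸ q.head_le i) hp⟩
      step := fun i => q.step i }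
  exact Order.LTSeries.length_le_krullDim q'

theorem supportDim_le_supportDim_quotient_ofList_add_length {R M : Type*} [CommRing R]
    [IsNoetherianRing R] [IsLocalRing R] [AddCommGroup M] [Module R M] [Module.Finite R M]
    (xs : List R) (hxs : ∀ x ∈ xs, x ∈ maximalIdeal R) :
    Module.supportDim R M ≤
      Module.supportDim R (M ⧸ (Ideal.ofList xs • ⊤ : Submodule R M)) + xs.length := by
  induction xs generalizing M with
  | nil =>
    rw [Ideal.ofList_nil, Submodule.bot_smul,
      Module.supportDim_eq_of_equiv (Submodule.quotEquivOfEqBot _ rfl)]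
    simp
  | cons x xs ih =>
    rw [Module.supportDim_eq_of_equiv
      (Submodule.quotOfListConsSMulTopEquivQuotSMulTopInner M x xs)]
    have h1 := Module.supportDim_le_supportDim_quotSMulTop_succ (M := M)
      (hxs x List.mem_cons_self)
    have h2 := ih (M := QuotSMulTop x M) fun r hr => hxs r (List.mem_cons_of_mem x hr)
    grw [h1, h2]
    simp [add_assoc]

theorem isWeaklyRegular_of_supportDim_add_length_le.{u} {R : Type u} [CommRing R]
    [IsNoetherianRing R] [IsLocalRing R] (xs : List R) (hxs : ∀ x ∈ xs, x ∈ maximalIdeal R)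
    {M : Type u} [AddCommGroup M] [Module R M] [Module.Finite R M] {d : ℕ}
    (hd : ∃ rs : List R, rs.length = d ∧ (∀ r ∈ rs, r ∈ maximalIdeal R) ∧ IsRegular M rs)
    (hdim : Module.supportDim R (M ⧸ (Ideal.ofList xs • ⊤ : Submodule R M)) + xs.length ≤ d) :
    IsWeaklyRegular M xs := by
  induction xs generalizing M d with
  | nil => exact .nil R M
  | cons x xs ih =>
    have hx := hxs x List.mem_cons_self
    have hxs' : ∀ r ∈ xs, r ∈ maximalIdeal R := fun r hr => hxs r (List.mem_cons_of_mem x hr)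
    have : Nontrivial M := by
      obtain ⟨rs, -, -, hrs⟩ := hd
      exact hrs.nontrivial
    have : Nontrivial (QuotSMulTop x M) := nontrivial_quotSMulTop_of_mem_maximalIdeal M hx
    rw [Module.supportDim_eq_of_equiv
      (Submodule.quotOfListConsSMulTopEquivQuotSMulTopInner M x xs)] at hdim
    have hle := supportDim_le_supportDim_quotient_ofList_add_length (M := QuotSMulTop x M) xs hxs'
    have hbot := Module.supportDim_ne_bot_of_nontrivial R (QuotSMulTop x M)
    obtain ⟨a, ha⟩ : ∃ a : ℕ, Module.supportDim R
        (QuotSMulTop x M ⧸ (Ideal.ofList xs • ⊤ : Submodule R (QuotSMulTop x M))) = a := by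
      generalize Module.supportDim R
        (QuotSMulTop x M ⧸ (Ideal.ofList xs • ⊤ : Submodule R (QuotSMulTop x M))) = a at hdim hle
      induction a with
      | bot =>
        rw [WithBot.bot_add, le_bot_iff] at hle
        exact (hbot hle).elim
      | coe a =>
        have ha : a + (x :: xs).length ≤ (d : ℕ∞) := by exact_mod_cast hdim
        exact ⟨a.toNat, by
          rw [← ENat.natCast_toNat
            (ne_top_of_le_ne_top (ENat.natCast_ne_top d) (le_self_add.trans ha))]
          simp⟩
    rw [ha] at hdim hle
    have hdim' : a + (xs.length + 1) ≤ d := by exact_mod_cast hdim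
    have hreg : IsSMulRegular M x := by
      by_contra hcon
      have hmem : x ∈ ⋃ p ∈ associatedPrimes R M, (p : Set R) := by
        rw [biUnion_associatedPrimes_eq_compl_regular R M]
        exact hcon
      obtain ⟨p, hp, hxp⟩ := Set.mem_iUnion₂.mp hmem
      obtain ⟨rs, hlen, hrs, hrsreg⟩ := hd
      let P : PrimeSpectrum R := ⟨p, IsAssociatedPrime.isPrime hp⟩
      have h1 := length_le_coheight_of_isAssociatedPrime rs hrs hrsreg.1 P hp
      have hP : P ∈ Module.support R (QuotSMulTop x M) := by
        rw [Module.support_quotSMulTop]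
        refine ⟨?_, by simpa [P] using hxp⟩
        rw [Module.mem_support_iff_of_finite]
        exact Submodule.annihilator_top (R := R) (M := M) ▸ IsAssociatedPrime.annihilator_le hp
      have h2 := (coheight_le_supportDim hP h1).trans hle
      have h3 : rs.length ≤ a + xs.length := by exact_mod_cast h2
      omega
    obtain ⟨d, rfl⟩ : ∃ k, d = k + 1 := ⟨d - 1, by omega⟩
    refine .cons hreg (ih hxs' (exists_isRegular_quotSMulTop hx hreg hd) ?_)
    rw [ha]
    exact_mod_cast (by omega : a + xs.length ≤ d)

theorem ringKrullDim_quotient_add_le {R : Type*} [CommRing R] {I : Ideal R} {n : ℕ}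
    (hI : ∀ p : PrimeSpectrum R, I ≤ p.asIdeal → (n : ℕ∞) ≤ Order.height p) :
    ringKrullDim (R ⧸ I) + n ≤ ringKrullDim R := by
  rw [ringKrullDim_quotient]
  rcases isEmpty_or_nonempty (PrimeSpectrum.zeroLocus (I : Set R)) with hE | hE
  · rw [Order.krullDim_eq_bot, WithBot.bot_add]
    exact bot_le
  have hlen : ∀ q : LTSeries (PrimeSpectrum.zeroLocus (I : Set R)),
      ((q.length + n : ℕ) : WithBot ℕ∞) ≤ ringKrullDim R := by
    intro q
    obtain ⟨r, hr, hrn⟩ := Order.exists_series_of_le_height q.head.1 (hI _ q.head.2)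
    have := Order.LTSeries.length_le_krullDim
      (r.smash (q.map Subtype.val fun _ _ h => h) hr)
    change ((r.length + q.length : ℕ) : WithBot ℕ∞) ≤ ringKrullDim R at this
    rwa [hrn, add_comm] at this
  obtain ⟨p⟩ := hE
  have : Nonempty (PrimeSpectrum R) := ⟨p.1⟩
  have hdim : ringKrullDim R = ((⨆ q : LTSeries (PrimeSpectrum R), (q.length : ℕ∞) : ℕ∞) :
      WithBot ℕ∞) := Order.krullDim_eq_iSup_length
  have : Nonempty (PrimeSpectrum.zeroLocus (I : Set R)) := ⟨p⟩
  rw [hdim] at hlen ⊢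
  rw [Order.krullDim_eq_iSup_length]
  have hle : (⨆ q : LTSeries (PrimeSpectrum.zeroLocus (I : Set R)), (q.length : ℕ∞)) + n ≤
      ⨆ q : LTSeries (PrimeSpectrum R), (q.length : ℕ∞) := by
    rw [ENat.iSup_add]
    exact iSup_le fun q => by exact_mod_cast hlen q
  exact_mod_cast hle

theorem mem_of_mul_mem_ofList {S : Type*} [CommRing S] (f : S) (l : List (S × S))
    (hreg : IsWeaklyRegular S (f :: l.map Prod.fst)) {z : S}
    (hz : z ∈ Ideal.ofList (l.map fun p => f * p.2 - p.1)) (hfz : f ∣ z) :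
    ∃ w ∈ Ideal.ofList (l.map fun p => f * p.2 - p.1), z = f * w := by
  induction l using List.reverseRecOn generalizing z with
  | nil => exact ⟨0, zero_mem _, by simpa using hz⟩
  | append_singleton l p ih =>
    obtain ⟨b, y⟩ := p
    rw [List.map_append, ← List.cons_append, isWeaklyRegular_append_iff] at hreg
    obtain ⟨hreg, hb⟩ := hreg
    simp only [List.map_cons, List.map_nil, isWeaklyRegular_singleton_iff,
      isSMulRegular_quotient_iff_mem_of_smul_mem] at hb
    simp only [List.map_append, List.map_cons, List.map_nil, Ideal.ofList_append,
      Ideal.ofList_singleton] at hz ⊢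
    set J := Ideal.ofList (l.map fun p => f * p.2 - p.1) with hJ
    have hsup : Ideal.ofList (f :: l.map Prod.fst) = Ideal.span {f} ⊔ J := by
      rw [Ideal.ofList_cons]
      have hf : f ∈ Ideal.span {f} := Ideal.mem_span_singleton_self f
      refine le_antisymm (sup_le le_sup_left ?_) (sup_le le_sup_left ?_)
      · refine Ideal.span_le.mpr fun c hc => ?_
        obtain ⟨p, hp, rfl⟩ := List.mem_map.mp hc
        have h1 : f * p.2 - p.1 ∈ J :=
          Ideal.subset_span (List.mem_map_of_mem (f := fun p => f * p.2 - p.1) hp)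
        have := Submodule.sub_mem _ (Ideal.mul_mem_right p.2 _ (Ideal.mem_sup_left (T := J) hf))
          (Ideal.mem_sup_right (S := Ideal.span {f}) h1)
        simpa using this
      · refine Ideal.span_le.mpr fun c hc => ?_
        obtain ⟨p, hp, rfl⟩ := List.mem_map.mp hc
        exact Submodule.sub_mem _ (Ideal.mul_mem_right p.2 _ (Ideal.mem_sup_left hf))
          (Ideal.mem_sup_right (Ideal.subset_span (List.mem_map_of_mem hp)))
    rw [smul_eq_mul, Ideal.mul_top, hsup] at hb
    obtain ⟨j, hj, t, ht, rfl⟩ := Submodule.mem_sup.mp hz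
    obtain ⟨h, rfl⟩ := Ideal.mem_span_singleton'.mp ht
    obtain ⟨g, hg⟩ := hfz
    have hh : h ∈ Ideal.span {f} ⊔ J := hb h <| by
      have hf : f ∈ Ideal.span {f} ⊔ J := Ideal.mem_sup_left (Ideal.mem_span_singleton_self f)
      have : b • h = f * (y * h - g) + j := by
        rw [smul_eq_mul]
        linear_combination -hg
      rw [this]
      exact add_mem (Ideal.mul_mem_right _ _ hf) (Ideal.mem_sup_right hj)
    obtain ⟨c, hc, k, hk, rfl⟩ := Submodule.mem_sup.mp hh
    obtain ⟨c, rfl⟩ := Ideal.mem_span_singleton'.mp hc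
    obtain ⟨w, hw, hjw⟩ := ih hreg (add_mem hj (Ideal.mul_mem_right (f * y - b) _ hk))
      ⟨g - c * (f * y - b), by linear_combination hg⟩
    refine ⟨w + c * (f * y - b), add_mem (Ideal.mem_sup_left hw) (Ideal.mem_sup_right
      (Ideal.mul_mem_left _ _ (Ideal.mem_span_singleton_self _))), ?_⟩
    linear_combination hjw

theorem IsCMLocalRing.isWeaklyRegular_of_length_le_height {R : Type*} [CommRing R]
    [IsNoetherianRing R] [IsLocalRing R] (hR : IsCMLocalRing R) (xs : List R)
    (hxs : ∀ x ∈ xs, x ∈ maximalIdeal R)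
    (hht : ∀ p : PrimeSpectrum R, Ideal.ofList xs ≤ p.asIdeal →
      (xs.length : ℕ∞) ≤ Order.height p) :
    IsWeaklyRegular R xs := by
  obtain ⟨rs, hrs, hreg, hdim⟩ := hR
  refine isWeaklyRegular_of_supportDim_add_length_le xs hxs ⟨rs, rfl, hrs, hreg⟩ ?_
  rw [smul_eq_mul, Ideal.mul_top, Module.supportDim_quotient_eq_ringKrullDim, ← hdim]
  exact ringKrullDim_quotient_add_le hht

theorem mem_davisIdeal_of_C_mul_mem {B : Type*} [CommRing B] {s : ℕ} {f : B} {c : Fin s → B}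
    (hreg : IsWeaklyRegular B (f :: List.ofFn c)) {g : MvPolynomial (Fin s) B}
    (hg : MvPolynomial.C f * g ∈ davisIdeal B s f c) : g ∈ davisIdeal B s f c := by
  let l : List (MvPolynomial (Fin s) B × MvPolynomial (Fin s) B) :=
    List.ofFn fun i => (MvPolynomial.C (c i), MvPolynomial.X i)
  have hJ : Ideal.ofList (l.map fun p => MvPolynomial.C f * p.2 - p.1) = davisIdeal B s f c := by
    simp only [l, List.map_ofFn, Ideal.ofList, davisIdeal, List.mem_ofFn]
    rfl
  have hl : MvPolynomial.C f :: l.map Prod.fst =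
      (f :: List.ofFn c).map (algebraMap B (MvPolynomial (Fin s) B)) := by
    simp only [l, List.map_ofFn, List.map_cons]
    rfl
  have hreg' : IsWeaklyRegular (MvPolynomial (Fin s) B) (MvPolynomial.C f :: l.map Prod.fst) :=
    hl ▸ hreg.of_flat
  obtain ⟨w, hw, hgw⟩ := mem_of_mul_mem_ofList _ l hreg' (hJ.symm ▸ hg) (dvd_mul_right _ _)
  rw [((isWeaklyRegular_cons_iff _ _ _).mp hreg').1 hgw, ← hJ]
  exact hw

theorem map_davisIdeal {B B' : Type*} [CommRing B] [CommRing B'] (φ : B →+* B') (s : ℕ) (f : B)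
    (c : Fin s → B) :
    (davisIdeal B s f c).map (MvPolynomial.map φ) = davisIdeal B' s (φ f) fun i => φ (c i) := by
  simp only [davisIdeal, Ideal.map_span, ← Set.range_comp]
  congr 2
  ext1 i
  simp

theorem IsCMRing.mem_davisIdeal_of_C_mul_mem {A : Type*} [CommRing A] [IsNoetherianRing A]
    (hA : IsCMRing A) {s : ℕ} {f : A} {c : Fin s → A}
    (hht : ∀ p : PrimeSpectrum A, f ∈ p.asIdeal → (∀ i, c i ∈ p.asIdeal) →
      ((s + 1 : ℕ) : ℕ∞) ≤ Order.height p)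
    {g : MvPolynomial (Fin s) A} (hg : MvPolynomial.C f * g ∈ davisIdeal A s f c) :
    g ∈ davisIdeal A s f c := by
  let 𝔞 : Ideal A := Submodule.comap
    ((LinearMap.toSpanSingleton _ (MvPolynomial (Fin s) A) g).restrictScalars A ∘ₗ
      Algebra.linearMap A (MvPolynomial (Fin s) A))
    ((davisIdeal A s f c).restrictScalars A)
  have h𝔞 : ∀ a, a ∈ 𝔞 ↔ MvPolynomial.C a * g ∈ davisIdeal A s f c := fun a => Iff.rfl
  by_contra hcon
  have htop : 𝔞 ≠ ⊤ := fun h => hcon <| by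
    simpa using (h𝔞 1).mp ((Ideal.eq_top_iff_one _).mp h)
  obtain ⟨m, hm, hle⟩ := Ideal.exists_le_maximal _ htop
  have hf : f ∈ m := hle ((h𝔞 f).mpr hg)
  have hc : ∀ i, c i ∈ m := fun i => hle <| (h𝔞 _).mpr <| by
    have hL : MvPolynomial.C f * MvPolynomial.X i - MvPolynomial.C (c i) ∈ davisIdeal A s f c :=
      Ideal.subset_span ⟨i, rfl⟩
    have := sub_mem (Ideal.mul_mem_left _ (MvPolynomial.X i) hg) (Ideal.mul_mem_left _ g hL)
    convert this using 1
    ring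
  have := hm.isPrime
  let R := Localization.AtPrime m
  let φ : A →+* R := algebraMap A R
  have hmem : ∀ a ∈ m, φ a ∈ maximalIdeal R := fun a ha =>
    (IsLocalization.AtPrime.to_map_mem_maximal_iff R m a).mpr ha
  have hreg : IsWeaklyRegular R (φ f :: List.ofFn fun i => φ (c i)) := by
    refine (hA m hm).isWeaklyRegular_of_length_le_height _ ?_ fun q hq => ?_
    · intro x hx
      rcases List.mem_cons.mp hx with rfl | hx
      · exact hmem _ hf
      · obtain ⟨i, rfl⟩ := List.mem_ofFn.mp hx
        exact hmem _ (hc i)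
    · have hq' : ∀ x ∈ φ f :: List.ofFn fun i => φ (c i), x ∈ q.asIdeal := fun x hx =>
        hq (Ideal.subset_span hx)
      have h1 := hht (PrimeSpectrum.comap φ q) (hq' _ List.mem_cons_self) fun i =>
        hq' _ (List.mem_cons_of_mem _ (List.mem_ofFn.mpr ⟨i, rfl⟩))
      have h2 := IsLocalization.height_under m.primeCompl q.asIdeal
      rw [List.length_cons, List.length_ofFn]
      rw [← PrimeSpectrum.height_eq_orderHeight] at h1 ⊢
      exact h1.trans h2.le
  have hφg : MvPolynomial.map φ g ∈ (davisIdeal A s f c).map (MvPolynomial.map φ) := by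
    rw [map_davisIdeal]
    refine _root_.mem_davisIdeal_of_C_mul_mem hreg ?_
    rw [← map_davisIdeal, ← MvPolynomial.map_C, ← map_mul]
    exact Ideal.mem_map_of_mem _ hg
  let := MvPolynomial.algebraMvPolynomial (σ := Fin s) (R := A) (S := R)
  obtain ⟨t, ht, htg⟩ := (IsLocalization.algebraMap_mem_map_algebraMap_iff
    (m.primeCompl.map (MvPolynomial.C (σ := Fin s))) (MvPolynomial (Fin s) R)
    (davisIdeal A s f c) g).mp hφg
  obtain ⟨a, ha, rfl⟩ := ht
  exact ha (hle ((h𝔞 a).mpr htg))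

theorem exists_C_pow_mul_sub_C_mem_davisIdeal {B : Type*} [CommRing B] {s : ℕ} (f : B)
    (c : Fin s → B) (p : MvPolynomial (Fin s) B) :
    ∃ (n : ℕ) (a : B), MvPolynomial.C (f ^ n) * p - MvPolynomial.C a ∈ davisIdeal B s f c := by
  induction p using MvPolynomial.induction_on with
  | C a => exact ⟨0, a, by simp⟩
  | add p q hp hq =>
    obtain ⟨n, a, hn⟩ := hp
    obtain ⟨k, b, hk⟩ := hq
    refine ⟨n + k, f ^ k * a + f ^ n * b, ?_⟩
    convert add_mem (Ideal.mul_mem_left _ (MvPolynomial.C (f ^ k)) hn)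
      (Ideal.mul_mem_left _ (MvPolynomial.C (f ^ n)) hk) using 1
    simp only [map_add, map_mul, pow_add]
    ring
  | mul_X p i hp =>
    obtain ⟨n, a, hn⟩ := hp
    have hL : MvPolynomial.C f * MvPolynomial.X i - MvPolynomial.C (c i) ∈ davisIdeal B s f c :=
      Ideal.subset_span ⟨i, rfl⟩
    refine ⟨n + 1, a * c i, ?_⟩
    convert add_mem (Ideal.mul_mem_left _ (MvPolynomial.C f * MvPolynomial.X i) hn)
      (Ideal.mul_mem_left _ (MvPolynomial.C a) hL) using 1
    simp only [map_mul, pow_succ]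
    ring

end

/-- **Proposition 2.9**: let `A` be a Noetherian Cohen–Macaulay domain with fraction
field `K`, and let `b₀ = f, b₁, …, b_s` (with `f ≠ 0`) be a semi-regular sequence, i.e.
the ideal it generates has height `s + 1`.  Then the affine modification
`A ↪ A' = A[(b₀, …, b_s)/f]` is a Davis modification: the ideal `J'` of
`A[y₁, …, y_s]` generated by the `f·y_i − b_i` is prime and equals the kernel of
`β : A[y₁, …, y_s] → K`, `y_i ↦ b_i/f`. -/
theorem stmt12 (A K : Type*) [CommRing A] [IsDomain A] [IsNoetherianRing A]
    [Field K] [Algebra A K] [IsFractionRing A K] (hCM : IsCMRing A)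
    (s : ℕ) (b : Fin (s + 1) → A) (f : A) (hb0 : b 0 = f) (hf : f ≠ 0)
    (hsemireg : idealHeight (Ideal.span (Set.range b)) = s + 1) :
    (davisIdeal A s f fun i => b i.succ).IsPrime ∧
    RingHom.ker (davisHom A K s f fun i => b i.succ) =
      davisIdeal A s f fun i => b i.succ := by
  have hfK : algebraMap A K f ≠ 0 := by simpa using hf
  have hker : RingHom.ker (davisHom A K s f fun i => b i.succ) =
      davisIdeal A s f fun i => b i.succ := by
    have hle : davisIdeal A s f (fun i => b i.succ) ≤
        RingHom.ker (davisHom A K s f fun i => b i.succ) := by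
      refine Ideal.span_le.mpr ?_
      rintro _ ⟨i, rfl⟩
      simp [davisHom, RingHom.mem_ker, mul_div_cancel₀ _ hfK]
    refine le_antisymm (fun p hp => ?_) hle
    have hht : ∀ q : PrimeSpectrum A, f ∈ q.asIdeal → (∀ i : Fin s, b i.succ ∈ q.asIdeal) →
        ((s + 1 : ℕ) : ℕ∞) ≤ Order.height q := fun q hfq hbq => by
      have hq : Ideal.span (Set.range b) ≤ q.asIdeal := by
        refine Ideal.span_le.mpr ?_
        rintro _ ⟨i, rfl⟩
        refine Fin.cases ?_ hbq i
        rwa [hb0]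
      have : idealHeight (Ideal.span (Set.range b)) ≤ Order.height q := iInf₂_le q hq
      rw [hsemireg] at this
      exact_mod_cast this
    obtain ⟨n, a, hn⟩ := exists_C_pow_mul_sub_C_mem_davisIdeal f (fun i : Fin s => b i.succ) p
    have ha : a = 0 := by
      have := hle hn
      rw [RingHom.mem_ker, map_sub, map_mul, (RingHom.mem_ker).mp hp] at this
      simpa [davisHom] using this
    rw [ha, map_zero, sub_zero] at hn
    clear ha
    induction n with
    | zero => simpa using hn
    | succ n ih =>
      refine ih (hCM.mem_davisIdeal_of_C_mul_mem hht ?_)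
      rwa [← mul_assoc, ← map_mul, ← pow_succ']
  exact ⟨hker ▸ RingHom.ker_isPrime _, hker⟩
end
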